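/- arXiv:1804.01651 — 2 statements merged into one kernel-verified Lean document; each statement's English description precedes it below -/
import Mathlib

section
/- (Theorem 1.2, multi-colored overpartition analogue) Let r ≥ 1 be an integer, let q ∈ ℂ with 0 < |q| < 1, and let a_1, …, a_r, z_1, …, z_r ∈ ℂ with |a_j| < 1 for all j. Then ∏_{j=1}^{r} (-a_j z_j q;q)_∞ / (a_j q;q)_∞ = 1 + Σ_{N=1}^∞ q^{N²} [∏_{j=1}^{r} (-a_j z_j q;q)_{N-1} / (a_j q;q)_{N-1}] · Σ_{i_1+⋯+i_r=N, i_t ≥ 0} [a_1^{i_1}⋯a_r^{i_r} (-z_1;q)_{i_1}⋯(-z_r;q)_{i_r} / ((q;q)_{i_1}⋯(q;q)_{i_r})] · (1 + Σ_{s=1}^{r} q^{i_1+i_2+⋯+i_{s-1}} (1 + z_s q^{i_s}) · [a_s q^N / (1 - a_s q^N)] · ∏_{k=1}^{s-1} [(1 + a_k z_k q^N)/(1 - a_k q^N)]), where the inner sum ranges over all r-tuples (i_1,…,i_r) of nonnegative integers summing to N and the outer series converges absolutely. (Note that |a_j q^m| < 1 for all m ≥ 1, so all denominators 1 - a_j q^m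 are nonzero.) -/
/-- The finite q-Pochhammer symbol `(a;q)_n = ∏_{k=0}^{n-1} (1 - a q^k)`. -/
noncomputable def qPoch (a q : ℂ) (n : ℕ) : ℂ := ∏ k ∈ Finset.range n, (1 - a * q ^ k)

/-- The infinite q-Pochhammer symbol `(a;q)_∞ = ∏_{k=0}^∞ (1 - a q^k)`. -/
noncomputable def qPochInf (a q : ℂ) : ℂ := ∏' k : ℕ, (1 - a * q ^ k)

/-- The `N`-th summand in the multi-colored overpartition analogue (Theorem 1.2). -/
noncomputable def overTerm (r : ℕ) (q : ℂ) (a z : Fin r → ℂ) (N : ℕ) : ℂ :=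
  q ^ (N ^ 2) * (∏ j : Fin r, qPoch (-(a j * z j) * q) q (N - 1) / qPoch (a j * q) q (N - 1)) *
    ∑ i ∈ Finset.Nat.antidiagonalTuple r N,
      ((∏ t : Fin r, a t ^ i t * qPoch (-z t) q (i t)) / ∏ t : Fin r, qPoch q q (i t)) *
        (1 + ∑ s : Fin r, q ^ (∑ t ∈ Finset.Iio s, i t) * (1 + z s * q ^ i s) *
            (a s * q ^ N / (1 - a s * q ^ N)) *
            ∏ k ∈ Finset.Iio s, (1 + a k * z k * q ^ N) / (1 - a k * q ^ N))

open PowerSeries Filter Topology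

/-- The generating series `∑ aⁿ (-z;q)_n / (q;q)_n Xⁿ` of a single color. -/
noncomputable def colorSeries (q a z : ℂ) : PowerSeries ℂ :=
  PowerSeries.mk fun n => a ^ n * qPoch (-z) q n / qPoch q q n

/-- The product of all color series, with `X` replaced by `q X` in the first `s` of them. -/
noncomputable def mixedSeries {r : ℕ} (q : ℂ) (a z : Fin r → ℂ) (s : ℕ) : PowerSeries ℂ :=
  ∏ t : Fin r, if t.val < s then rescale q (colorSeries q (a t) (z t))
    else colorSeries q (a t) (z t)

/-- The tail, from degree `n` on, of the evaluation of a power series at `x`. -/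
noncomputable def seriesTail (g : PowerSeries ℂ) (x : ℂ) (n : ℕ) : ℂ :=
  ∑' m : ℕ, coeff (n + m) g * x ^ (n + m)

/-- The product over the first `s` colors of `(1 + a z x) / (1 - a x)`. -/
noncomputable def colorRatio {r : ℕ} (a z : Fin r → ℂ) (x : ℂ) (s : ℕ) : ℂ :=
  ∏ k : Fin r with k.val < s, (1 + a k * z k * x) / (1 - a k * x)

lemma one_sub_ne_zero_of_norm_lt_one {w : ℂ} (hw : ‖w‖ < 1) : 1 - w ≠ 0 := by
  intro h
  rw [sub_eq_zero] at h
  simp [← h] at hw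

lemma norm_mul_lt_one {u v : ℂ} (hu : ‖u‖ < 1) (hv : ‖v‖ < 1) : ‖u * v‖ < 1 := by
  rw [norm_mul]
  exact mul_lt_one_of_nonneg_of_lt_one_left (norm_nonneg _) hu hv.le

lemma norm_pow_succ_lt_one {q : ℂ} (hq : ‖q‖ < 1) (n : ℕ) : ‖q ^ (n + 1)‖ < 1 := by
  rw [norm_pow]
  exact pow_lt_one₀ (norm_nonneg _) hq n.succ_ne_zero

lemma qPoch_succ (a q : ℂ) (n : ℕ) : qPoch a q (n + 1) = qPoch a q n * (1 - a * q ^ n) :=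
  Finset.prod_range_succ _ _

lemma qPoch_self_ne_zero {q : ℂ} (hq : ‖q‖ < 1) (n : ℕ) : qPoch q q n ≠ 0 := by
  refine Finset.prod_ne_zero_iff.2 fun k _ => one_sub_ne_zero_of_norm_lt_one ?_
  rw [← pow_succ']
  exact norm_pow_succ_lt_one hq k

lemma coeff_colorSeries_succ {q : ℂ} (hq : ‖q‖ < 1) (a z : ℂ) (n : ℕ) :
    coeff (n + 1) (colorSeries q a z) =
      a * (1 + z * q ^ n) / (1 - q ^ (n + 1)) * coeff n (colorSeries q a z) := by
  have h1 := qPoch_self_ne_zero hq n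
  have h2 := one_sub_ne_zero_of_norm_lt_one (norm_pow_succ_lt_one hq n)
  simp only [colorSeries, coeff_mk, qPoch_succ, ← pow_succ']
  field_simp
  ring

lemma colorSeries_functional {q : ℂ} (hq : ‖q‖ < 1) (a z : ℂ) :
    (1 - C a * X) * colorSeries q a z =
      (1 + C (a * z) * X) * rescale q (colorSeries q a z) := by
  ext n
  cases n with
  | zero =>
    have h := coeff_rescale (colorSeries q a z) q 0
    rw [pow_zero, one_mul, coeff_zero_eq_constantCoeff_apply,
      coeff_zero_eq_constantCoeff_apply] at h
    simp [sub_mul, add_mul, mul_assoc, h]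
  | succ n =>
    have h2 := one_sub_ne_zero_of_norm_lt_one (norm_pow_succ_lt_one hq n)
    simp only [sub_mul, add_mul, one_mul, mul_assoc, map_sub, map_add, coeff_C_mul,
      coeff_succ_X_mul, coeff_rescale, coeff_colorSeries_succ hq]
    field_simp
    ring

lemma summable_colorSeries {q : ℂ} (hq : ‖q‖ < 1) {a : ℂ} (ha : ‖a‖ < 1) (z : ℂ) {x : ℂ}
    (hx : ‖x‖ < 1) : Summable fun n => ‖coeff n (colorSeries q a z) * x ^ n‖ := by
  have hpow : Tendsto (fun n : ℕ => q ^ n) atTop (𝓝 0) :=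
    tendsto_pow_atTop_nhds_zero_of_norm_lt_one hq
  have hlim : Tendsto (fun n : ℕ => ‖a * (1 + z * q ^ n) / (1 - q ^ (n + 1)) * x‖) atTop
      (𝓝 ‖a * (1 + z * 0) / (1 - 0) * x‖) := by
    have hnum := ((hpow.const_mul z).const_add 1).const_mul a
    have hden := ((tendsto_add_atTop_iff_nat 1).2 hpow).const_sub 1
    exact ((hnum.div hden (by simp)).mul_const x).norm
  have hax : ‖a * (1 + z * 0) / (1 - 0) * x‖ < 1 := by simpa using norm_mul_lt_one ha hx
  obtain ⟨ρ, h1, h2⟩ := exists_between hax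
  refine (summable_of_ratio_norm_eventually_le
    (f := fun n => coeff n (colorSeries q a z) * x ^ n) h2 ?_).norm
  filter_upwards [hlim.eventually_lt_const h1] with n hn
  rw [coeff_colorSeries_succ hq, pow_succ x, mul_comm _ x, mul_mul_mul_comm, norm_mul]
  gcongr

lemma summable_coeff_rescale {q : ℂ} (hq : ‖q‖ < 1) {g : PowerSeries ℂ} {x : ℂ}
    (hg : Summable fun n => ‖coeff n g * x ^ n‖) :
    Summable fun n => ‖coeff n (rescale q g) * x ^ n‖ := by
  refine hg.of_nonneg_of_le (fun _ => norm_nonneg _) fun n => ?_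
  rw [coeff_rescale, mul_assoc, norm_mul, norm_pow]
  exact mul_le_of_le_one_left (norm_nonneg _) (pow_le_one₀ (norm_nonneg _) hq.le)

lemma summable_coeff_mul {f g : PowerSeries ℂ} {x : ℂ}
    (hf : Summable fun n => ‖coeff n f * x ^ n‖) (hg : Summable fun n => ‖coeff n g * x ^ n‖) :
    Summable fun n => ‖coeff n (f * g) * x ^ n‖ := by
  refine (summable_norm_sum_mul_antidiagonal_of_summable_norm hf hg).congr fun n => ?_
  rw [coeff_mul, Finset.sum_mul]
  congr 1
  refine Finset.sum_congr rfl fun k hk => ?_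
  rw [← Finset.HasAntidiagonal.mem_antidiagonal.1 hk, pow_add]
  ring

lemma summable_mixedSeries {r : ℕ} {q : ℂ} (hq : ‖q‖ < 1) {a : Fin r → ℂ} (ha : ∀ j, ‖a j‖ < 1)
    (z : Fin r → ℂ) (s : ℕ) {x : ℂ} (hx : ‖x‖ < 1) :
    Summable fun n => ‖coeff n (mixedSeries q a z s) * x ^ n‖ := by
  refine Finset.prod_induction _ (fun g => Summable fun n => ‖coeff n g * x ^ n‖)
    (fun _ _ => summable_coeff_mul) ?_ fun t _ => ?_
  · refine summable_of_ne_finset_zero (s := {0}) fun n hn => ?_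
    simp [coeff_one, Finset.notMem_singleton.1 hn]
  · have h := summable_colorSeries hq (ha t) (z t) hx
    split_ifs
    exacts [summable_coeff_rescale hq h, h]

lemma mixedSeries_functional {r : ℕ} {q : ℂ} (hq : ‖q‖ < 1) (a z : Fin r → ℂ) (s : Fin r) :
    (1 - C (a s) * X) * mixedSeries q a z s =
      (1 + C (a s * z s) * X) * mixedSeries q a z (s + 1) := by
  have hrest : ∏ t ∈ Finset.univ.erase s, (if t.val < s.val + 1 then
        rescale q (colorSeries q (a t) (z t)) else colorSeries q (a t) (z t)) =
      ∏ t ∈ Finset.univ.erase s, if t.val < s.val then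
        rescale q (colorSeries q (a t) (z t)) else colorSeries q (a t) (z t) := by
    refine Finset.prod_congr rfl fun t ht => ?_
    have := Fin.val_ne_of_ne (Finset.ne_of_mem_erase ht)
    simp only [show t.val < s.val + 1 ↔ t.val < s.val by omega]
  simp only [mixedSeries, ← Finset.mul_prod_erase Finset.univ _ (Finset.mem_univ s), hrest]
  simp only [lt_irrefl, if_false, Nat.lt_succ_self, if_true, ← mul_assoc,
    colorSeries_functional hq]

lemma mixedSeries_all {r : ℕ} (q : ℂ) (a z : Fin r → ℂ) :
    mixedSeries q a z r = rescale q (mixedSeries q a z 0) := by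
  simp [mixedSeries, map_prod]

lemma coeff_mixedSeries {r : ℕ} (q : ℂ) (a z : Fin r → ℂ) (s n : ℕ) :
    coeff n (mixedSeries q a z s) = ∑ i ∈ Finset.Nat.antidiagonalTuple r n,
      ((∏ t : Fin r, a t ^ i t * qPoch (-z t) q (i t)) / ∏ t : Fin r, qPoch q q (i t)) *
        q ^ (∑ t : Fin r with t.val < s, i t) := by
  rw [mixedSeries, coeff_prod]
  refine Finset.sum_equiv Finsupp.equivFunOnFinite (fun i => ?_) fun i _ => ?_
  · simp [Finset.Nat.mem_antidiagonalTuple]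
  · rw [← Finset.prod_div_distrib, ← Finset.prod_pow_eq_pow_sum, Finset.prod_filter,
      ← Finset.prod_mul_distrib]
    refine Finset.prod_congr rfl fun t _ => ?_
    split_ifs <;> simp [colorSeries, mul_comm]

lemma coeff_zero_mixedSeries {r : ℕ} (q : ℂ) (a z : Fin r → ℂ) (s : ℕ) :
    coeff 0 (mixedSeries q a z s) = 1 := by
  rw [coeff_mixedSeries, Finset.Nat.antidiagonalTuple_zero_right]
  simp [qPoch]

lemma coeff_mixedSeries_combination {r : ℕ} (q : ℂ) (a z : Fin r → ℂ) (s : Fin r) (n : ℕ) :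
    a s * coeff n (mixedSeries q a z s) + a s * z s * coeff n (mixedSeries q a z (s + 1)) =
      ∑ i ∈ Finset.Nat.antidiagonalTuple r n,
      ((∏ t : Fin r, a t ^ i t * qPoch (-z t) q (i t)) / ∏ t : Fin r, qPoch q q (i t)) *
        (q ^ (∑ t ∈ Finset.Iio s, i t) * (1 + z s * q ^ i s) * a s) := by
  have h0 : (Finset.univ.filter fun t : Fin r => t.val < s.val) = Finset.Iio s := by
    ext t; simp
  have h1 : (Finset.univ.filter fun t : Fin r => t.val < s.val + 1) =
      insert s (Finset.Iio s) := by
    ext t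
    simp only [Finset.mem_filter, Finset.mem_univ, true_and, Finset.mem_insert, Finset.mem_Iio,
      Fin.ext_iff, Fin.lt_def]
    omega
  rw [coeff_mixedSeries, coeff_mixedSeries, Finset.mul_sum, Finset.mul_sum,
    ← Finset.sum_add_distrib]
  refine Finset.sum_congr rfl fun i _ => ?_
  rw [h0, h1, Finset.sum_insert (by simp), pow_add]
  ring

lemma colorRatio_succ {r : ℕ} (a z : Fin r → ℂ) (x : ℂ) (s : Fin r) :
    colorRatio a z x (s + 1) = colorRatio a z x s * ((1 + a s * z s * x) / (1 - a s * x)) := by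
  have h1 : (Finset.univ.filter fun t : Fin r => t.val < s.val + 1) =
      insert s (Finset.univ.filter fun t : Fin r => t.val < s.val) := by
    ext t
    simp only [Finset.mem_filter, Finset.mem_univ, true_and, Finset.mem_insert, Fin.ext_iff]
    omega
  rw [colorRatio, h1, Finset.prod_insert (by simp), mul_comm, colorRatio]

lemma summable_tail {g : PowerSeries ℂ} {x : ℂ} (hg : Summable fun n => ‖coeff n g * x ^ n‖)
    (n : ℕ) : Summable fun m => coeff (n + m) g * x ^ (n + m) := by
  simpa only [add_comm n] using (summable_nat_add_iff n).2 hg.of_norm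

lemma seriesTail_eq_add {g : PowerSeries ℂ} {x : ℂ}
    (hg : Summable fun n => ‖coeff n g * x ^ n‖) (n : ℕ) :
    seriesTail g x n = coeff n g * x ^ n + seriesTail g x (n + 1) := by
  rw [seriesTail, (summable_tail hg n).tsum_eq_zero_add, seriesTail]
  simp only [add_zero, add_assoc, add_comm 1]

lemma seriesTail_rescale (q : ℂ) (g : PowerSeries ℂ) (x : ℂ) (n : ℕ) :
    seriesTail (rescale q g) x n = seriesTail g (q * x) n := by
  simp only [seriesTail, coeff_rescale, mul_pow]
  exact tsum_congr fun m => by ring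

lemma tsum_linear_combination {D : PowerSeries ℂ} {x : ℂ}
    (hD : Summable fun n => ‖coeff n D * x ^ n‖) (a : ℂ) (n : ℕ) :
    ∑' m, coeff (n + 1 + m) ((1 + C a * X) * D) * x ^ (n + 1 + m) =
      (1 + a * x) * seriesTail D x (n + 1) + x ^ (n + 1) * (a * coeff n D) := by
  have h : ∀ m, coeff (n + 1 + m) ((1 + C a * X) * D) * x ^ (n + 1 + m) =
      coeff (n + 1 + m) D * x ^ (n + 1 + m) + a * x * (coeff (n + m) D * x ^ (n + m)) := by
    intro m
    rw [show n + 1 + m = n + m + 1 by ring, add_mul, one_mul, mul_assoc, map_add, coeff_C_mul,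
      coeff_succ_X_mul]
    ring
  simp only [h]
  rw [(summable_tail hD _).tsum_add ((summable_tail hD n).mul_left _), tsum_mul_left,
    ← seriesTail, ← seriesTail, seriesTail_eq_add hD n]
  ring

lemma seriesTail_functional {D B : PowerSeries ℂ} {x a b : ℂ}
    (hD : Summable fun n => ‖coeff n D * x ^ n‖) (hB : Summable fun n => ‖coeff n B * x ^ n‖)
    (h : (1 - C a * X) * D = (1 + C b * X) * B) (n : ℕ) :
    (1 - a * x) * seriesTail D x (n + 1) - (1 + b * x) * seriesTail B x (n + 1) =
      x ^ (n + 1) * (a * coeff n D + b * coeff n B) := by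
  have h' : (1 + C (-a) * X) * D = (1 + C b * X) * B := by
    rw [← h, map_neg]; ring
  have hDa := tsum_linear_combination hD (-a) n
  rw [h', tsum_linear_combination hB] at hDa
  linear_combination -hDa

lemma seriesTail_zero_functional {D B : PowerSeries ℂ} {x a b : ℂ}
    (hD : Summable fun n => ‖coeff n D * x ^ n‖) (hB : Summable fun n => ‖coeff n B * x ^ n‖)
    (h : (1 - C a * X) * D = (1 + C b * X) * B) :
    (1 - a * x) * seriesTail D x 0 = (1 + b * x) * seriesTail B x 0 := by
  have h0 : coeff 0 D = coeff 0 B := by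
    simpa [sub_mul, add_mul, mul_assoc] using congrArg (coeff 0) h
  rw [seriesTail_eq_add hD, seriesTail_eq_add hB, h0]
  have := seriesTail_functional hD hB h 0
  rw [h0] at this
  linear_combination this

lemma norm_seriesTail_le {g : PowerSeries ℂ} {q y : ℂ} (hy : ‖y‖ ≤ 1)
    (hg : Summable fun n => ‖coeff n g * q ^ n‖) (n : ℕ) :
    ‖seriesTail g (q * y) (n + 1)‖ ≤ ‖y‖ * ∑' m, ‖coeff m g * q ^ m‖ := by
  have hs : Summable fun m => ‖coeff (n + 1 + m) g * q ^ (n + 1 + m)‖ := by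
    simpa only [add_comm (n + 1)] using (summable_nat_add_iff (n + 1)).2 hg
  have hle : ∑' m, ‖coeff (n + 1 + m) g * q ^ (n + 1 + m)‖ ≤ ∑' m, ‖coeff m g * q ^ m‖ :=
    hs.tsum_le_tsum_of_inj (fun m => n + 1 + m) (add_right_injective _)
      (fun _ _ => norm_nonneg _) (fun _ => le_rfl) hg
  refine (tsum_of_norm_bounded (hs.mul_left ‖y‖).hasSum fun m => ?_).trans ?_
  · rw [mul_pow, ← mul_assoc, norm_mul, mul_comm, norm_pow]
    gcongr
    exact pow_le_of_le_one (norm_nonneg _) hy (by omega)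
  · rw [tsum_mul_left]
    gcongr

lemma seriesTail_telescope {r : ℕ} {q : ℂ} (hq : ‖q‖ < 1) {a : Fin r → ℂ}
    (ha : ∀ j, ‖a j‖ < 1) (z : Fin r → ℂ) {x : ℂ} (hx : ‖x‖ < 1) (n : ℕ) :
    seriesTail (mixedSeries q a z 0) x (n + 1) -
        colorRatio a z x r * seriesTail (mixedSeries q a z 0) (q * x) (n + 1) =
      ∑ s : Fin r, colorRatio a z x s * (x ^ (n + 1) * (a s * coeff n (mixedSeries q a z s) +
        a s * z s * coeff n (mixedSeries q a z (s + 1))) / (1 - a s * x)) := by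
  set U : ℕ → ℂ := fun s => colorRatio a z x s * seriesTail (mixedSeries q a z s) x (n + 1)
    with hU
  have hstep : ∀ s : Fin r, colorRatio a z x s * (x ^ (n + 1) *
      (a s * coeff n (mixedSeries q a z s) +
        a s * z s * coeff n (mixedSeries q a z (s + 1))) / (1 - a s * x)) =
      U s - U (s + 1) := by
    intro s
    have hne := one_sub_ne_zero_of_norm_lt_one (norm_mul_lt_one (ha s) hx)
    rw [← seriesTail_functional (summable_mixedSeries hq ha z s hx)
      (summable_mixedSeries hq ha z (s + 1) hx) (mixedSeries_functional hq a z s) n]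
    simp only [hU, colorRatio_succ]
    field_simp
  rw [Finset.sum_congr rfl fun s _ => hstep s,
    Fin.sum_univ_eq_sum_range (fun s => U s - U (s + 1)) r, Finset.sum_range_sub']
  simp [hU, mixedSeries_all, seriesTail_rescale, colorRatio]

lemma seriesTail_zero_eq {r : ℕ} {q : ℂ} (hq : ‖q‖ < 1) {a : Fin r → ℂ}
    (ha : ∀ j, ‖a j‖ < 1) (z : Fin r → ℂ) {x : ℂ} (hx : ‖x‖ < 1) :
    seriesTail (mixedSeries q a z 0) x 0 =
      colorRatio a z x r * seriesTail (mixedSeries q a z 0) (q * x) 0 := by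
  have key : ∀ s ≤ r, seriesTail (mixedSeries q a z 0) x 0 =
      colorRatio a z x s * seriesTail (mixedSeries q a z s) x 0 := by
    intro s
    induction s with
    | zero => simp [colorRatio]
    | succ s ih =>
      intro hs
      have hne := one_sub_ne_zero_of_norm_lt_one (norm_mul_lt_one (ha ⟨s, hs⟩) hx)
      have h := seriesTail_zero_functional (summable_mixedSeries hq ha z s hx)
        (summable_mixedSeries hq ha z (s + 1) hx) (mixedSeries_functional hq a z ⟨s, hs⟩)
      rw [ih (by omega), colorRatio_succ a z x ⟨s, hs⟩]
      field_simp
      linear_combination colorRatio a z x s * h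
  rw [key r le_rfl, mixedSeries_all, seriesTail_rescale]

/-- The product over all colors of `(-a z q;q)_n / (a q;q)_n`. -/
noncomputable def pochRatio {r : ℕ} (q : ℂ) (a z : Fin r → ℂ) (n : ℕ) : ℂ :=
  ∏ j : Fin r, qPoch (-(a j * z j) * q) q n / qPoch (a j * q) q n

lemma pochRatio_succ {r : ℕ} (q : ℂ) (a z : Fin r → ℂ) (n : ℕ) :
    pochRatio q a z (n + 1) = pochRatio q a z n * colorRatio a z (q ^ (n + 1)) r := by
  simp only [pochRatio, colorRatio, Fin.is_lt, Finset.filter_true, ← Finset.prod_mul_distrib]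
  refine Finset.prod_congr rfl fun j _ => ?_
  rw [qPoch_succ, qPoch_succ, mul_div_mul_comm]
  congr 2 <;> ring

lemma summable_norm_const_mul_pow {q : ℂ} (hq : ‖q‖ < 1) (a : ℂ) :
    Summable fun k : ℕ => ‖-(a * q ^ k)‖ := by
  simpa using (summable_geometric_of_lt_one (norm_nonneg q) hq).mul_left ‖a‖

lemma tendsto_qPoch {q : ℂ} (hq : ‖q‖ < 1) (a : ℂ) :
    Tendsto (qPoch a q) atTop (𝓝 (qPochInf a q)) := by
  have h := multipliable_one_add_of_summable (summable_norm_const_mul_pow hq a)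
  simpa only [← sub_eq_add_neg] using! h.tendsto_prod_tprod_nat

lemma qPochInf_ne_zero {q a : ℂ} (hq : ‖q‖ < 1) (ha : ‖a‖ < 1) : qPochInf a q ≠ 0 := by
  have h := tprod_one_add_ne_zero_of_summable (f := fun k : ℕ => -(a * q ^ k)) (fun k => ?_)
    (summable_norm_const_mul_pow hq a)
  · simpa only [← sub_eq_add_neg] using! h
  · rw [← sub_eq_add_neg]
    refine one_sub_ne_zero_of_norm_lt_one ?_
    rw [norm_mul, norm_pow]
    exact mul_lt_one_of_nonneg_of_lt_one_left (norm_nonneg _) ha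
      (pow_le_one₀ (norm_nonneg _) hq.le)

lemma tendsto_pochRatio {r : ℕ} {q : ℂ} (hq : ‖q‖ < 1) {a : Fin r → ℂ}
    (ha : ∀ j, ‖a j‖ < 1) (z : Fin r → ℂ) :
    Tendsto (pochRatio q a z) atTop
      (𝓝 (∏ j : Fin r, qPochInf (-(a j * z j) * q) q / qPochInf (a j * q) q)) :=
  tendsto_finsetProd _ fun j _ => (tendsto_qPoch hq _).div (tendsto_qPoch hq _)
    (qPochInf_ne_zero hq (norm_mul_lt_one (ha j) hq))

lemma overTerm_succ {r : ℕ} {q : ℂ} (hq : ‖q‖ < 1) {a : Fin r → ℂ}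
    (ha : ∀ j, ‖a j‖ < 1) (z : Fin r → ℂ) (n : ℕ) :
    overTerm r q a z (n + 1) =
      pochRatio q a z n * seriesTail (mixedSeries q a z 0) (q ^ (n + 1)) (n + 1) -
      pochRatio q a z (n + 1) *
        seriesTail (mixedSeries q a z 0) (q ^ (n + 2)) (n + 2) := by
  have hx := norm_pow_succ_lt_one hq n
  have htel := seriesTail_telescope hq ha z hx (n + 1)
  have hadd := seriesTail_eq_add (summable_mixedSeries hq ha z 0 hx) (n + 1)
  rw [← pow_succ'] at htel
  have hsum : seriesTail (mixedSeries q a z 0) (q ^ (n + 1)) (n + 1) -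
      colorRatio a z (q ^ (n + 1)) r *
        seriesTail (mixedSeries q a z 0) (q ^ (n + 2)) (n + 2) =
      coeff (n + 1) (mixedSeries q a z 0) * (q ^ (n + 1)) ^ (n + 1) +
      ∑ s : Fin r, colorRatio a z (q ^ (n + 1)) s * ((q ^ (n + 1)) ^ (n + 2) *
        (a s * coeff (n + 1) (mixedSeries q a z s) +
        a s * z s * coeff (n + 1) (mixedSeries q a z (s + 1))) / (1 - a s * q ^ (n + 1))) := by
    linear_combination htel + hadd
  rw [pochRatio_succ, mul_assoc, ← mul_sub, hsum]
  simp only [coeff_mixedSeries_combination]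
  rw [coeff_mixedSeries, overTerm, ← pow_mul, ← sq, Nat.add_sub_cancel, ← pochRatio,
    mul_comm (q ^ (n + 1) ^ 2), mul_assoc]
  congr 1
  simp only [mul_add, mul_one, Finset.sum_add_distrib, not_lt_zero, Finset.filter_false,
    Finset.sum_empty, pow_zero]
  congr 1
  · ring
  · simp only [Finset.mul_sum, Finset.sum_div]
    rw [Finset.sum_comm]
    refine Finset.sum_congr rfl fun s _ => Finset.sum_congr rfl fun i _ => ?_
    have h0 : (Finset.univ.filter fun t : Fin r => t.val < s.val) = Finset.Iio s := by
      ext t; simp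
    rw [colorRatio, h0]
    ring

/-- Theorem 1.2: the multi-colored overpartition analogue of Alladi's identity. -/
theorem multicolored_overpartition_identity (r : ℕ) (hr : 1 ≤ r) (q : ℂ)
    (hq0 : 0 < ‖q‖) (hq : ‖q‖ < 1) (a z : Fin r → ℂ) (ha : ∀ j, ‖a j‖ < 1) :
    Summable (fun N : ℕ => ‖overTerm r q a z (N + 1)‖) ∧
    (∏ j : Fin r, qPochInf (-(a j * z j) * q) q / qPochInf (a j * q) q) =
      1 + ∑' N : ℕ, overTerm r q a z (N + 1) := by
  set A := mixedSeries q a z 0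
  set S : ℕ → ℂ := fun n => pochRatio q a z n * seriesTail A (q ^ (n + 1)) (n + 1) with hS
  have hterm : ∀ n, overTerm r q a z (n + 1) = S n - S (n + 1) := overTerm_succ hq ha z
  have hAs : Summable fun n => ‖coeff n A * q ^ n‖ := summable_mixedSeries hq ha z 0 hq
  have hlim := tendsto_pochRatio hq ha z
  have htail : ∀ n m, ‖seriesTail A (q ^ (n + 1)) (m + 1)‖ ≤
      ‖q‖ ^ n * ∑' m, ‖coeff m A * q ^ m‖ := fun n m => by
    rw [pow_succ', ← norm_pow]
    exact norm_seriesTail_le (by rw [norm_pow]; exact pow_le_one₀ (norm_nonneg _) hq.le) hAs m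
  obtain ⟨K, hK⟩ := hlim.norm.bddAbove_range
  have hSle : ∀ n, ‖S n‖ ≤ K * (‖q‖ ^ n * ∑' m, ‖coeff m A * q ^ m‖) := fun n => by
    rw [hS, norm_mul]
    have hKn : ‖pochRatio q a z n‖ ≤ K := hK ⟨n, rfl⟩
    exact mul_le_mul hKn (htail n n) (norm_nonneg _) ((norm_nonneg _).trans hKn)
  have hSs : Summable fun n => ‖S n‖ :=
    (((summable_geometric_of_lt_one (norm_nonneg q) hq).mul_right _).mul_left K).of_nonneg_of_le
      (fun _ => norm_nonneg _) hSle
  have hTs : Summable fun n => ‖overTerm r q a z (n + 1)‖ := by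
    refine (hSs.add ((summable_nat_add_iff 1).2 hSs)).of_nonneg_of_le
      (fun _ => norm_nonneg _) fun n => ?_
    rw [hterm]
    exact norm_sub_le _ _
  have hsum : ∑' n, overTerm r q a z (n + 1) = S 0 := by
    refine tendsto_nhds_unique hTs.of_norm.hasSum.tendsto_sum_nat ?_
    simp only [hterm, Finset.sum_range_sub']
    simpa using hSs.of_norm.tendsto_atTop_zero.const_sub (S 0)
  have hA0 : ∀ n, seriesTail A (q ^ (n + 1)) 0 = 1 + seriesTail A (q ^ (n + 1)) 1 := fun n => by
    rw [seriesTail_eq_add (summable_mixedSeries hq ha z 0 (norm_pow_succ_lt_one hq n)),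
      coeff_zero_mixedSeries, pow_zero, mul_one]
  have hS0 : S 0 = seriesTail A (q ^ 1) 1 := by
    simp [hS, pochRatio, qPoch]
  have hinv : ∀ n, 1 + S 0 = pochRatio q a z n * seriesTail A (q ^ (n + 1)) 0 := by
    intro n
    induction n with
    | zero => rw [hS0, hA0]; simp [pochRatio, qPoch]
    | succ n ih =>
      rw [ih, seriesTail_zero_eq hq ha z (norm_pow_succ_lt_one hq n), ← mul_assoc,
        ← pochRatio_succ, ← pow_succ']
  have hone : Tendsto (fun n => seriesTail A (q ^ (n + 1)) 0) atTop (𝓝 1) := by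
    have h0 : Tendsto (fun n => seriesTail A (q ^ (n + 1)) 1) atTop (𝓝 0) := by
      refine squeeze_zero_norm (fun n => htail n 0) ?_
      simpa using (tendsto_pow_atTop_nhds_zero_of_lt_one (norm_nonneg q) hq).mul_const
        (∑' m, ‖coeff m A * q ^ m‖)
    simpa [hA0] using h0.const_add 1
  refine ⟨hTs, ?_⟩
  rw [hsum]
  refine tendsto_nhds_unique ?_ (tendsto_const_nhds (x := 1 + S 0) (f := atTop (α := ℕ)))
  simpa [← hinv] using hlim.mul hone
end

section
/- (Equation (4.1) of the paper: Alladi's identity refined by the number of parts) Let r ≥ 1 be an integer, let q ∈ ℂ with |q| < 1, and let a_1, …, a_r, y ∈ ℂ. Then ∏_{j=1}^{r} (-a_j y q;q)_∞ = 1 + Σ_{N=1}^∞ (y q^N)^N [∏_{j=1}^{r} (-a_j y q;q)_{N-1}] · Σ_{i_1+⋯+i_r=N, i_t ≥ 0} [a_1^{i_1}⋯a_r^{i_r} q^{C(i_1,2)+⋯+C(i_r,2)} / ((q;q)_{i_1}⋯(q;q)_{i_r})] · (1 + Σ_{s=1}^{r} q^{i_1+i_2+⋯+i_s} a_s y q^N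 ∏_{k=1}^{s-1} (1 + a_k y q^N)), where the inner sum ranges over all r-tuples (i_1,…,i_r) of nonnegative integers summing to N, C(i,2) = i(i-1)/2, and the outer series converges absolutely. -/
/-- The `N`-th summand in equation (4.1) of the paper. -/
noncomputable def alladiRefinedTerm (r : ℕ) (q y : ℂ) (a : Fin r → ℂ) (N : ℕ) : ℂ :=
  (y * q ^ N) ^ N * (∏ j : Fin r, qPoch (-(a j * y) * q) q (N - 1)) *
    ∑ i ∈ Finset.Nat.antidiagonalTuple r N,
      ((∏ t : Fin r, a t ^ i t) * q ^ (∑ t : Fin r, Nat.choose (i t) 2) /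
          ∏ t : Fin r, qPoch q q (i t)) *
        (1 + ∑ s : Fin r, q ^ (∑ t ∈ Finset.Iic s, i t) * a s * y * q ^ N *
            ∏ k ∈ Finset.Iio s, (1 + a k * y * q ^ N))

/-- The summand `∏_t a_t^{i_t} q^{C(i_t,2)} / (q;q)_{i_t}` of the coefficient of `x^N` in
`∏_t (-a_t x;q)_∞`. -/
noncomputable def eulerWeight {r : ℕ} (q : ℂ) (a : Fin r → ℂ) (i : Fin r → ℕ) : ℂ :=
  ∏ t : Fin r, a t ^ i t * q ^ (i t).choose 2 / qPoch q q (i t)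

/-- The coefficient of `x^N` in `∏_t (-a_t x;q)_∞`. -/
noncomputable def eulerCoeff {r : ℕ} (q : ℂ) (a : Fin r → ℂ) (N : ℕ) : ℂ :=
  ∑ i ∈ Finset.Nat.antidiagonalTuple r N, eulerWeight q a i

/-- The inner sum of `alladiRefinedTerm`, as a function of `x = y q^N`. -/
noncomputable def refinedInnerSum {r : ℕ} (q : ℂ) (a : Fin r → ℂ) (N : ℕ) (x : ℂ) : ℂ :=
  ∑ i ∈ Finset.Nat.antidiagonalTuple r N, eulerWeight q a i *
    (1 + ∑ s : Fin r, q ^ (∑ t ∈ Finset.Iic s, i t) * (a s * x) *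
      ∏ k ∈ Finset.Iio s, (1 + a k * x))

theorem alladiRefinedTerm_eq (r : ℕ) (q y : ℂ) (a : Fin r → ℂ) (N : ℕ) :
    alladiRefinedTerm r q y a N = (y * q ^ N) ^ N *
      (∏ j : Fin r, qPoch (-(a j * y) * q) q (N - 1)) * refinedInnerSum q a N (y * q ^ N) := by
  unfold alladiRefinedTerm refinedInnerSum eulerWeight
  simp only [Finset.prod_div_distrib, Finset.prod_mul_distrib, Finset.prod_pow_eq_pow_sum,
    mul_assoc]

theorem qPoch_self_succ (q : ℂ) (n : ℕ) :
    qPoch q q (n + 1) = qPoch q q n * (1 - q ^ (n + 1)) := by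
  rw [qPoch, Finset.prod_range_succ, ← qPoch, pow_succ']

theorem one_sub_pow_succ_ne_zero {q : ℂ} (hq : ‖q‖ < 1) (n : ℕ) : 1 - q ^ (n + 1) ≠ 0 := by
  intro h
  have h1 : ‖q ^ (n + 1)‖ = 1 := by rw [← sub_eq_zero.mp h, norm_one]
  rw [norm_pow] at h1
  exact (pow_lt_one₀ (norm_nonneg q) hq n.succ_ne_zero).ne h1

theorem qPoch_mul_succ (b q : ℂ) (n : ℕ) :
    qPoch (b * q) q (n + 1) = (1 - b * q) * qPoch (b * q * q) q n := by
  rw [qPoch, Finset.prod_range_succ', mul_comm, qPoch]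
  congr 1
  · ring
  · refine Finset.prod_congr rfl fun k _ => ?_
    ring

theorem eulerWeight_add_single {r : ℕ} {q : ℂ} (hq : ‖q‖ < 1) (a : Fin r → ℂ) (s : Fin r)
    (j : Fin r → ℕ) :
    eulerWeight q a (j + Pi.single s 1) * (1 - q ^ (j s + 1)) =
      eulerWeight q a j * (a s * q ^ j s) := by
  unfold eulerWeight
  rw [← Finset.mul_prod_erase _ _ (Finset.mem_univ s),
    ← Finset.mul_prod_erase (a := s) _ (fun t => a t ^ j t * q ^ (j t).choose 2 / qPoch q q (j t))
      (Finset.mem_univ s)]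
  have h : ∏ t ∈ Finset.univ.erase s, a t ^ (j + Pi.single s 1 : Fin r → ℕ) t *
        q ^ ((j + Pi.single s 1 : Fin r → ℕ) t).choose 2 / qPoch q q ((j + Pi.single s 1 : Fin r → ℕ) t) =
      ∏ t ∈ Finset.univ.erase s, a t ^ j t * q ^ (j t).choose 2 / qPoch q q (j t) := by
    refine Finset.prod_congr rfl fun t ht => ?_
    simp [Pi.single_eq_of_ne (Finset.ne_of_mem_erase ht)]
  rw [h]
  simp only [Pi.add_apply, Pi.single_eq_same, qPoch_self_succ, Nat.choose_succ_succ' (j s) 1,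
    Nat.choose_one_right, pow_add, pow_one]
  have := one_sub_pow_succ_ne_zero hq (j s)
  rw [pow_succ] at this
  rw [← div_div]
  field_simp

theorem sum_eulerWeight_mul_one_sub {r : ℕ} {q : ℂ} (hq : ‖q‖ < 1) (a : Fin r → ℂ) (N : ℕ)
    (s : Fin r) :
    ∑ i ∈ Finset.Nat.antidiagonalTuple r (N + 1),
        eulerWeight q a i * (q ^ (∑ t ∈ Finset.Iio s, i t) * (1 - q ^ i s)) =
      ∑ j ∈ Finset.Nat.antidiagonalTuple r N,
        eulerWeight q a j * (a s * q ^ (∑ t ∈ Finset.Iic s, j t)) := by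
  symm
  refine Finset.sum_of_injOn (fun j => j + Pi.single s 1) (fun _ _ _ _ h => add_right_cancel h)
    ?_ ?_ ?_
  · intro j hj
    simp only [Finset.mem_coe, Finset.Nat.mem_antidiagonalTuple] at hj ⊢
    simp [Finset.sum_add_distrib, hj]
  · intro i hi hn
    rcases Nat.eq_zero_or_pos (i s) with h0 | h0
    · simp [h0]
    · refine absurd ⟨i - Pi.single s 1, ?_, ?_⟩ hn
      · have hle : (Pi.single s 1 : Fin r → ℕ) ≤ i := by
          intro t
          by_cases h : t = s
          · subst h; simpa using Nat.succ_le_of_lt h0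
          · simp [Pi.single_eq_of_ne h]
        have h1 := congrArg (fun f : Fin r → ℕ => ∑ t, f t) (tsub_add_cancel_of_le hle)
        simp only [Finset.Nat.mem_antidiagonalTuple] at hi
        simp only [Pi.add_apply, Finset.sum_add_distrib, hi] at h1
        simp only [Finset.mem_coe, Finset.Nat.mem_antidiagonalTuple]
        simpa using h1
      · funext t
        by_cases h : t = s
        · subst h
          simp
          omega
        · simp [Pi.single_eq_of_ne h]
  · intro j _
    have h : ∑ t ∈ Finset.Iio s, (j + Pi.single s 1 : Fin r → ℕ) t = ∑ t ∈ Finset.Iio s, j t := by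
      refine Finset.sum_congr rfl fun t ht => ?_
      simp [Pi.single_eq_of_ne (Finset.mem_Iio.mp ht).ne]
    have h2 := eulerWeight_add_single hq a s j
    have h3 : ∑ t ∈ Finset.Iic s, j t = j s + ∑ t ∈ Finset.Iio s, j t := by
      rw [← Finset.Iio_insert, Finset.sum_insert (by simp)]
    simp only [h, h3]
    simp only [Pi.add_apply, Pi.single_eq_same, pow_add] at h2 ⊢
    linear_combination -(q ^ (∑ t ∈ Finset.Iio s, j t)) * h2

theorem one_add_sum_pow_mul_prod {r : ℕ} (q : ℂ) (b : Fin r → ℂ) (i : Fin r → ℕ) :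
    1 + ∑ s : Fin r, q ^ (∑ t ∈ Finset.Iic s, i t) * b s * ∏ k ∈ Finset.Iio s, (1 + b k) =
      q ^ (∑ t, i t) * ∏ k, (1 + b k) +
        ∑ s : Fin r, q ^ (∑ t ∈ Finset.Iio s, i t) * (1 - q ^ i s) *
          ∏ k ∈ Finset.Iio s, (1 + b k) := by
  have h := Finset.prod_one_sub_ordered Finset.univ fun t => 1 - q ^ i t * (1 + b t)
  have hf (s : Fin r) : Finset.univ.filter (fun j => j < s) = Finset.Iio s := by ext; simp
  simp only [sub_sub_cancel, hf, Finset.prod_mul_distrib, Finset.prod_pow_eq_pow_sum] at h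
  rw [h, sub_add, ← Finset.sum_sub_distrib, sub_eq_add_neg, ← Finset.sum_neg_distrib]
  congr 1
  refine Finset.sum_congr rfl fun s _ => ?_
  have h3 : ∑ t ∈ Finset.Iic s, i t = i s + ∑ t ∈ Finset.Iio s, i t := by
    rw [← Finset.Iio_insert, Finset.sum_insert (by simp)]
  rw [h3, pow_add]
  ring

theorem refinedInnerSum_succ {r : ℕ} {q : ℂ} (hq : ‖q‖ < 1) (a : Fin r → ℂ) (N : ℕ) (x : ℂ) :
    x * refinedInnerSum q a (N + 1) x =
      x * q ^ (N + 1) * (∏ k, (1 + a k * x)) * eulerCoeff q a (N + 1) +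
        (refinedInnerSum q a N x - eulerCoeff q a N) := by
  have h1 : refinedInnerSum q a (N + 1) x =
      q ^ (N + 1) * (∏ k, (1 + a k * x)) * eulerCoeff q a (N + 1) +
        ∑ s : Fin r, (∏ k ∈ Finset.Iio s, (1 + a k * x)) *
          ∑ i ∈ Finset.Nat.antidiagonalTuple r (N + 1),
            eulerWeight q a i * (q ^ (∑ t ∈ Finset.Iio s, i t) * (1 - q ^ i s)) := by
    simp only [refinedInnerSum, eulerCoeff, Finset.mul_sum]
    rw [Finset.sum_comm, ← Finset.sum_add_distrib]
    refine Finset.sum_congr rfl fun i hi => ?_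
    rw [one_add_sum_pow_mul_prod, Finset.Nat.mem_antidiagonalTuple.mp hi, mul_add,
      Finset.mul_sum]
    congr 1
    · ring
    · refine Finset.sum_congr rfl fun s _ => ?_
      ring
  have h2 : refinedInnerSum q a N x - eulerCoeff q a N =
      ∑ s : Fin r, x * ((∏ k ∈ Finset.Iio s, (1 + a k * x)) *
        ∑ j ∈ Finset.Nat.antidiagonalTuple r N,
          eulerWeight q a j * (a s * q ^ (∑ t ∈ Finset.Iic s, j t))) := by
    simp only [refinedInnerSum, eulerCoeff, Finset.mul_sum]
    rw [Finset.sum_comm, ← Finset.sum_sub_distrib]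
    refine Finset.sum_congr rfl fun i _ => ?_
    rw [mul_add, mul_one, add_sub_cancel_left, Finset.mul_sum]
    refine Finset.sum_congr rfl fun s _ => ?_
    ring
  rw [h1, h2, ← Finset.mul_sum]
  simp only [sum_eulerWeight_mul_one_sub hq]
  ring

theorem eulerCoeff_zero {r : ℕ} (q : ℂ) (a : Fin r → ℂ) : eulerCoeff q a 0 = 1 := by
  simp [eulerCoeff, eulerWeight, Finset.Nat.antidiagonalTuple_zero_right, qPoch]

theorem refinedInnerSum_zero {r : ℕ} (q : ℂ) (a : Fin r → ℂ) (x : ℂ) :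
    refinedInnerSum q a 0 x = ∏ k, (1 + a k * x) := by
  have h := one_add_sum_pow_mul_prod q (fun k => a k * x) (fun _ => 0)
  simp only [Finset.sum_const_zero, pow_zero, sub_self, mul_zero, zero_mul, add_zero, one_mul] at h
  simp [refinedInnerSum, eulerWeight, Finset.Nat.antidiagonalTuple_zero_right, qPoch, h]

theorem prod_qPoch_mul_succ {r : ℕ} (q y : ℂ) (a : Fin r → ℂ) (n : ℕ) :
    ∏ j, qPoch (-(a j * y) * q) q (n + 1) =
      (∏ j, (1 + a j * (y * q))) * ∏ j, qPoch (-(a j * (y * q)) * q) q n := by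
  rw [← Finset.prod_mul_distrib]
  refine Finset.prod_congr rfl fun j _ => ?_
  rw [qPoch_mul_succ]
  ring_nf

theorem prod_qPoch_succ {r : ℕ} (q y : ℂ) (a : Fin r → ℂ) (n : ℕ) :
    ∏ j, qPoch (-(a j * y) * q) q (n + 1) =
      (∏ j, qPoch (-(a j * y) * q) q n) * ∏ j, (1 + a j * (y * q ^ (n + 1))) := by
  rw [← Finset.prod_mul_distrib]
  refine Finset.prod_congr rfl fun j _ => ?_
  rw [qPoch, Finset.prod_range_succ, ← qPoch]
  ring

/-- The recurrence behind the functional equation `G(y) = ∏_j (1 + a_j y q) G(y q)`. -/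
theorem alladiRefinedTerm_succ_succ {r : ℕ} {q : ℂ} (hq : ‖q‖ < 1) (y : ℂ) (a : Fin r → ℂ)
    (N : ℕ) :
    alladiRefinedTerm r q y a (N + 2) =
      (∏ j, qPoch (-(a j * y) * q) q (N + 2)) * (y * q ^ (N + 3)) ^ (N + 2) *
          eulerCoeff q a (N + 2) -
        (∏ j, qPoch (-(a j * y) * q) q (N + 1)) * (y * q ^ (N + 2)) ^ (N + 1) *
          eulerCoeff q a (N + 1) +
        (∏ j, (1 + a j * (y * q))) * alladiRefinedTerm r q (y * q) a (N + 1) := by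
  have hx : y * q * q ^ (N + 1) = y * q ^ (N + 2) := by ring
  have h1 : (y * q ^ (N + 2)) ^ (N + 2) = (y * q ^ (N + 2)) ^ (N + 1) * (y * q ^ (N + 2)) :=
    pow_succ _ _
  have h2 : (y * q ^ (N + 3)) ^ (N + 2) =
      (y * q ^ (N + 2)) ^ (N + 1) * (y * q ^ (N + 2)) * q ^ (N + 2) := by ring
  simp only [alladiRefinedTerm_eq, hx, h1, h2, prod_qPoch_succ q y a (N + 1),
    show N + 2 - 1 = N + 1 from rfl, Nat.add_sub_cancel]
  have hP := prod_qPoch_mul_succ q y a N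
  linear_combination (y * q ^ (N + 2)) ^ (N + 1) *
      (∏ j, qPoch (-(a j * y) * q) q (N + 1)) *
        refinedInnerSum_succ hq a (N + 1) (y * q ^ (N + 2)) +
      (y * q ^ (N + 2)) ^ (N + 1) * refinedInnerSum q a (N + 1) (y * q ^ (N + 2)) * hP

theorem alladiRefinedTerm_one {r : ℕ} {q : ℂ} (hq : ‖q‖ < 1) (y : ℂ) (a : Fin r → ℂ) :
    alladiRefinedTerm r q y a 1 =
      (∏ j, (1 + a j * (y * q))) * (1 + y * q ^ 2 * eulerCoeff q a 1) - 1 := by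
  have h := refinedInnerSum_succ hq a 0 (y * q)
  rw [refinedInnerSum_zero, eulerCoeff_zero] at h
  simp only [zero_add, pow_one] at h
  simp only [alladiRefinedTerm_eq, qPoch, pow_one, Nat.sub_self, Finset.range_zero,
    Finset.prod_empty, Finset.prod_const_one, mul_one]
  linear_combination h

/-- Closed form for the partial sums. -/
theorem one_add_sum_alladiRefinedTerm {r : ℕ} {q : ℂ} (hq : ‖q‖ < 1) (a : Fin r → ℂ) (M : ℕ)
    (y : ℂ) :
    1 + ∑ N ∈ Finset.range M, alladiRefinedTerm r q y a (N + 1) =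
      (∏ j, qPoch (-(a j * y) * q) q M) *
        ∑ m ∈ Finset.range (M + 1), eulerCoeff q a m * (y * q ^ (M + 1)) ^ m := by
  induction M generalizing y with
  | zero => simp [qPoch, eulerCoeff_zero]
  | succ M ih =>
    have hfe : 1 + ∑ N ∈ Finset.range (M + 1), alladiRefinedTerm r q y a (N + 1) =
        (∏ j, qPoch (-(a j * y) * q) q (M + 1)) * (y * q ^ (M + 2)) ^ (M + 1) *
            eulerCoeff q a (M + 1) +
          (∏ j, (1 + a j * (y * q))) *
            (1 + ∑ N ∈ Finset.range M, alladiRefinedTerm r q (y * q) a (N + 1)) := by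
      clear ih
      induction M with
      | zero =>
        simp only [prod_qPoch_succ]
        simp [alladiRefinedTerm_one hq, qPoch]
        ring
      | succ M ih =>
        rw [Finset.sum_range_succ, ← add_assoc, ih, alladiRefinedTerm_succ_succ hq,
          Finset.sum_range_succ _ M]
        ring
    have hx : y * q * q ^ (M + 1) = y * q ^ (M + 2) := by ring
    rw [hfe, ih, hx, Finset.sum_range_succ _ (M + 1), prod_qPoch_mul_succ]
    ring

theorem card_antidiagonalTuple_le (r N : ℕ) :
    (Finset.Nat.antidiagonalTuple r N).card ≤ (2 ^ r) ^ N := by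
  have hsub : Finset.Nat.antidiagonalTuple r N ⊆
      Fintype.piFinset fun _ : Fin r => Finset.range (N + 1) := by
    intro i hi
    rw [Finset.Nat.mem_antidiagonalTuple] at hi
    rw [Fintype.mem_piFinset]
    intro t
    rw [Finset.mem_range, Nat.lt_succ_iff, ← hi]
    exact Finset.single_le_sum (fun _ _ => Nat.zero_le _) (Finset.mem_univ t)
  calc _ ≤ _ := Finset.card_le_card hsub
    _ = (N + 1) ^ r := by simp
    _ ≤ (2 ^ N) ^ r := Nat.pow_le_pow_left Nat.lt_two_pow_self r
    _ = (2 ^ r) ^ N := by rw [← pow_mul, ← pow_mul, mul_comm]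

theorem norm_qPoch_self_ge {q : ℂ} (hq : ‖q‖ < 1) (n : ℕ) :
    (1 - ‖q‖) ^ n ≤ ‖qPoch q q n‖ := by
  rw [qPoch, norm_prod, ← Finset.card_range n, ← Finset.prod_const, Finset.card_range]
  refine Finset.prod_le_prod (fun _ _ => by linarith) fun k _ => ?_
  have h : ‖q * q ^ k‖ ≤ ‖q‖ := by
    rw [norm_mul, norm_pow]
    exact mul_le_of_le_one_right (norm_nonneg q) (pow_le_one₀ (norm_nonneg q) hq.le)
  have := norm_sub_norm_le 1 (q * q ^ k)
  rw [norm_one] at this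
  linarith

theorem norm_eulerWeight_le {r : ℕ} {q : ℂ} (hq : ‖q‖ < 1) (a : Fin r → ℂ) (i : Fin r → ℕ) :
    ‖eulerWeight q a i‖ ≤ ((∑ t, ‖a t‖) / (1 - ‖q‖)) ^ ∑ t, i t := by
  rw [eulerWeight, norm_prod, ← Finset.prod_pow_eq_pow_sum]
  refine Finset.prod_le_prod (fun _ _ => norm_nonneg _) fun t _ => ?_
  have hpos : 0 < 1 - ‖q‖ := by linarith
  rw [norm_div, norm_mul, norm_pow, norm_pow, div_pow]
  have ha : ‖a t‖ ≤ ∑ t, ‖a t‖ :=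
    Finset.single_le_sum (f := fun t => ‖a t‖) (fun _ _ => norm_nonneg _) (Finset.mem_univ t)
  have h1 : ‖q‖ ^ (i t).choose 2 ≤ 1 := pow_le_one₀ (norm_nonneg q) hq.le
  have h2 : ‖a t‖ ^ i t ≤ (∑ t, ‖a t‖) ^ i t := pow_le_pow_left₀ (norm_nonneg _) ha _
  refine div_le_div₀ (by positivity) ?_ (by positivity) (norm_qPoch_self_ge hq _)
  exact (mul_le_of_le_one_right (by positivity) h1).trans h2

/-- Sums over compositions of `N` weighted by `eulerWeight` grow at most geometrically. -/
theorem norm_sum_eulerWeight_mul_le {r : ℕ} {q : ℂ} (hq : ‖q‖ < 1) (a : Fin r → ℂ) (N : ℕ)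
    (f : (Fin r → ℕ) → ℂ) {C : ℝ} (hf : ∀ i, ‖f i‖ ≤ C) :
    ‖∑ i ∈ Finset.Nat.antidiagonalTuple r N, eulerWeight q a i * f i‖ ≤
      (2 ^ r * ((∑ t, ‖a t‖) / (1 - ‖q‖))) ^ N * C := by
  have hpos : 0 < 1 - ‖q‖ := by linarith
  have hR : 0 ≤ (∑ t, ‖a t‖) / (1 - ‖q‖) := by positivity
  have hC : 0 ≤ C := (norm_nonneg _).trans (hf 0)
  have hterm : ∀ i ∈ Finset.Nat.antidiagonalTuple r N,
      ‖eulerWeight q a i * f i‖ ≤ ((∑ t, ‖a t‖) / (1 - ‖q‖)) ^ N * C := by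
    intro i hi
    rw [norm_mul]
    have h := norm_eulerWeight_le hq a i
    rw [Finset.Nat.mem_antidiagonalTuple.mp hi] at h
    exact mul_le_mul h (hf i) (norm_nonneg _) (by positivity)
  refine (norm_sum_le_of_le _ hterm).trans ?_
  rw [Finset.sum_const, nsmul_eq_mul, mul_pow, mul_assoc]
  refine mul_le_mul_of_nonneg_right ?_ (by positivity)
  exact_mod_cast card_antidiagonalTuple_le r N

theorem norm_eulerCoeff_le {r : ℕ} {q : ℂ} (hq : ‖q‖ < 1) (a : Fin r → ℂ) (N : ℕ) :
    ‖eulerCoeff q a N‖ ≤ (2 ^ r * ((∑ t, ‖a t‖) / (1 - ‖q‖))) ^ N := by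
  simpa [eulerCoeff] using norm_sum_eulerWeight_mul_le hq a N (fun _ => 1) (C := 1) (by simp)

theorem norm_refinedInnerSum_le {r : ℕ} {q : ℂ} (hq : ‖q‖ < 1) (a : Fin r → ℂ) (N : ℕ)
    {x : ℂ} {Y : ℝ} (hx : ‖x‖ ≤ Y) :
    ‖refinedInnerSum q a N x‖ ≤ (2 ^ r * ((∑ t, ‖a t‖) / (1 - ‖q‖))) ^ N *
      (1 + ∑ s : Fin r, ‖a s‖ * Y * ∏ k ∈ Finset.Iio s, (1 + ‖a k‖ * Y)) := by
  have hY : 0 ≤ Y := (norm_nonneg x).trans hx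
  refine norm_sum_eulerWeight_mul_le hq a N _ fun i => ?_
  refine (norm_add_le _ _).trans (add_le_add norm_one.le ?_)
  refine norm_sum_le_of_le _ fun s _ => ?_
  have hb (k : Fin r) : ‖a k * x‖ ≤ ‖a k‖ * Y := by
    rw [norm_mul]
    exact mul_le_mul_of_nonneg_left hx (norm_nonneg _)
  rw [norm_mul, norm_mul, norm_pow, norm_prod]
  refine mul_le_mul ?_ ?_ (by positivity) (by positivity)
  · exact (mul_le_of_le_one_left (norm_nonneg _)
      (pow_le_one₀ (norm_nonneg q) hq.le)).trans (hb s)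
  · refine Finset.prod_le_prod (fun _ _ => norm_nonneg _) fun k _ => ?_
    exact (norm_add_le _ _).trans (add_le_add norm_one.le (hb k))

theorem norm_qPoch_le {q : ℂ} (hq : ‖q‖ < 1) (b : ℂ) (n : ℕ) :
    ‖qPoch b q n‖ ≤ (1 + ‖b‖) ^ n := by
  rw [qPoch, norm_prod]
  refine (Finset.prod_le_prod (g := fun _ => 1 + ‖b‖) (fun _ _ => norm_nonneg _)
    fun k _ => ?_).trans_eq (by simp)
  refine (norm_sub_le _ _).trans (add_le_add norm_one.le ?_)
  rw [norm_mul, norm_pow]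
  exact mul_le_of_le_one_right (norm_nonneg b) (pow_le_one₀ (norm_nonneg q) hq.le)

theorem summable_pow_mul_pow_self {K ρ : ℝ} (hK : 0 ≤ K) (hρ : 0 ≤ ρ) (hρ1 : ρ < 1) :
    Summable fun N : ℕ => (K * ρ ^ N) ^ N := by
  have hlim : Filter.Tendsto (fun N : ℕ => K * ρ ^ N) Filter.atTop (nhds 0) := by
    simpa using (tendsto_pow_atTop_nhds_zero_of_lt_one hρ hρ1).const_mul K
  refine Summable.of_norm_bounded_eventually_nat summable_geometric_two ?_
  filter_upwards [hlim.eventually_le_const (u := 1 / 2) (by norm_num)] with N hN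
  rw [Real.norm_of_nonneg (by positivity)]
  exact pow_le_pow_left₀ (by positivity) hN N

theorem summable_norm_alladiRefinedTerm {r : ℕ} {q : ℂ} (hq : ‖q‖ < 1) (a : Fin r → ℂ) (y : ℂ) :
    Summable fun N : ℕ => ‖alladiRefinedTerm r q y a N‖ := by
  have hpos : 0 < 1 - ‖q‖ := by linarith
  set R : ℝ := 2 ^ r * ((∑ t, ‖a t‖) / (1 - ‖q‖))
  set L : ℝ := ∏ j, (1 + ‖-(a j * y) * q‖)
  set C : ℝ := 1 + ∑ s : Fin r, ‖a s‖ * ‖y‖ * ∏ k ∈ Finset.Iio s, (1 + ‖a k‖ * ‖y‖)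
  have hR0 : 0 ≤ R := by positivity
  have hL1 : 1 ≤ L := Finset.one_le_prod fun j _ =>
    le_add_of_nonneg_right (norm_nonneg _)
  have hC0 : 0 ≤ C := by positivity
  refine Summable.of_nonneg_of_le (fun _ => norm_nonneg _) (fun N => ?_)
    ((summable_pow_mul_pow_self (K := ‖y‖ * L * R) (by positivity) (norm_nonneg q) hq).mul_right C)
  have hx : ‖y * q ^ N‖ ≤ ‖y‖ := by
    rw [norm_mul, norm_pow]
    exact mul_le_of_le_one_right (norm_nonneg y) (pow_le_one₀ (norm_nonneg q) hq.le)
  have h1 := norm_refinedInnerSum_le hq a N hx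
  have h2 : ‖∏ j, qPoch (-(a j * y) * q) q (N - 1)‖ ≤ L ^ N := by
    rw [norm_prod]
    refine (Finset.prod_le_prod (fun _ _ => norm_nonneg _)
      fun j _ => norm_qPoch_le hq _ _).trans ?_
    rw [Finset.prod_pow]
    exact pow_le_pow_right₀ hL1 (Nat.sub_le N 1)
  rw [alladiRefinedTerm_eq, norm_mul, norm_mul, norm_pow, norm_mul, norm_pow]
  calc _ ≤ (‖y‖ * ‖q‖ ^ N) ^ N * L ^ N * (R ^ N * C) :=
        mul_le_mul (mul_le_mul_of_nonneg_left h2 (by positivity)) h1 (norm_nonneg _)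
          (by positivity)
    _ = _ := by simp only [mul_pow]; ring

theorem tendsto_sum_eulerCoeff {r : ℕ} {q : ℂ} (hq : ‖q‖ < 1) (a : Fin r → ℂ) (y : ℂ) :
    Filter.Tendsto
      (fun M : ℕ => ∑ m ∈ Finset.range (M + 1), eulerCoeff q a m * (y * q ^ (M + 1)) ^ m)
      Filter.atTop (nhds 1) := by
  have hpos : 0 < 1 - ‖q‖ := by linarith
  set R : ℝ := 2 ^ r * ((∑ t, ‖a t‖) / (1 - ‖q‖))
  have hR0 : 0 ≤ R := by positivity
  have hlim : Filter.Tendsto (fun M : ℕ => R * ‖y‖ * ‖q‖ ^ (M + 1)) Filter.atTop (nhds 0) := by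
    simpa using ((Filter.tendsto_add_atTop_iff_nat 1).mpr
      (tendsto_pow_atTop_nhds_zero_of_lt_one (norm_nonneg q) hq)).const_mul (R * ‖y‖)
  have hlim2 : Filter.Tendsto (fun M : ℕ => M * (R * ‖y‖ * ‖q‖ ^ (M + 1)))
      Filter.atTop (nhds 0) := by
    have h := (tendsto_self_mul_const_pow_of_lt_one (norm_nonneg q) hq).const_mul
      (R * ‖y‖ * ‖q‖)
    rw [mul_zero] at h
    refine h.congr fun M => ?_
    ring
  rw [tendsto_iff_norm_sub_tendsto_zero]
  refine squeeze_zero' (Filter.Eventually.of_forall fun _ => norm_nonneg _) ?_ hlim2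
  filter_upwards [hlim.eventually_le_const (u := 1) one_pos] with M hM
  rw [Finset.sum_range_succ', eulerCoeff_zero, pow_zero, mul_one, add_sub_cancel_right]
  refine (norm_sum_le_of_le (f := fun m => eulerCoeff q a (m + 1) * (y * q ^ (M + 1)) ^ (m + 1))
    (n := fun _ => R * ‖y‖ * ‖q‖ ^ (M + 1)) _ fun m _ => ?_).trans_eq (by simp)
  rw [norm_mul, norm_pow, norm_mul, norm_pow]
  calc _ ≤ R ^ (m + 1) * (‖y‖ * ‖q‖ ^ (M + 1)) ^ (m + 1) :=
        mul_le_mul_of_nonneg_right (norm_eulerCoeff_le hq a _) (by positivity)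
    _ = (R * ‖y‖ * ‖q‖ ^ (M + 1)) ^ (m + 1) := by rw [← mul_pow, mul_assoc R]
    _ ≤ _ := pow_le_of_le_one (by positivity) hM m.succ_ne_zero

theorem tendsto_qPoch_s12 {q : ℂ} (hq : ‖q‖ < 1) (b : ℂ) :
    Filter.Tendsto (qPoch b q) Filter.atTop (nhds (qPochInf b q)) := by
  have hs : Summable fun k : ℕ => ‖-(b * q ^ k)‖ := by
    simpa [norm_mul, norm_pow] using
      (summable_geometric_of_lt_one (norm_nonneg q) hq).mul_left ‖b‖
  have h := (multipliable_one_add_of_summable hs).hasProd.tendsto_prod_nat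
  simp only [← sub_eq_add_neg] at h
  exact h

/-- Equation (4.1) of the paper: Alladi's identity refined by the number of parts. -/
theorem alladi_refined_by_parts (r : ℕ) (hr : 1 ≤ r) (q : ℂ) (hq : ‖q‖ < 1)
    (a : Fin r → ℂ) (y : ℂ) :
    Summable (fun N : ℕ => ‖alladiRefinedTerm r q y a (N + 1)‖) ∧
    (∏ j : Fin r, qPochInf (-(a j * y) * q) q) =
      1 + ∑' N : ℕ, alladiRefinedTerm r q y a (N + 1) := by
  have hs : Summable fun N : ℕ => ‖alladiRefinedTerm r q y a (N + 1)‖ :=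
    (summable_nat_add_iff 1).mpr (summable_norm_alladiRefinedTerm hq a y)
  refine ⟨hs, ?_⟩
  have h1 := (hs.of_norm.hasSum.tendsto_sum_nat).const_add 1
  simp only [one_add_sum_alladiRefinedTerm hq] at h1
  have h2 := (tendsto_finsetProd Finset.univ
    fun j _ => tendsto_qPoch_s12 hq (-(a j * y) * q)).mul (tendsto_sum_eulerCoeff hq a y)
  rw [mul_one] at h2
  exact tendsto_nhds_unique h2 h1
end
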